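/- Every recursively squashable subset of a compact metrizable space is squashable. -/

import Mathlib

open Metric Set Function

universe u v

/-- A collection of subsets of a (pseudo)metric space is *null* if for every `ε > 0`
only finitely many of its members have diameter `≥ ε`. -/
def IsNullCollection {X : Type u} [PseudoMetricSpace X] (𝒞 : Set (Set X)) : Prop :=
  ∀ ε : ℝ, 0 < ε → {C | C ∈ 𝒞 ∧ ε ≤ Metric.diam C}.Finite

/-- An upper semi-continuous decomposition of a space `X`: a partition of `X` into
nonempty compact subsets such that the quotient map to the quotient space
(with the quotient topology) is a closed map. -/
def IsUSCDecomposition {X : Type u} [TopologicalSpace X] (𝒢 : Set (Set X)) : Prop :=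
  (∀ G ∈ 𝒢, IsCompact G ∧ G.Nonempty) ∧
  (∀ x : X, ∃! G, G ∈ 𝒢 ∧ x ∈ G) ∧
  IsClosedMap (Quot.mk (fun x y : X => ∃ G ∈ 𝒢, x ∈ G ∧ y ∈ G))

/-- `f` maps `S` homeomorphically onto `T`. -/
def MapsHomeomorphicallyOnto {X : Type u} {Y : Type v} [TopologicalSpace X]
    [TopologicalSpace Y] (f : X → Y) (S : Set X) (T : Set Y) : Prop :=
  ∃ e : S ≃ₜ T, ∀ x : S, (e x : Y) = f (x : X)

/-- A compact subset `A` of a metric space `X` is *squeezable* if for every null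
upper semi-continuous decomposition `𝒢` of `X` with `A ∈ 𝒢`, every open neighborhood
`U` of `A` and every `δ > 0`, there is a homeomorphism `h : X → X` which is the identity
on `X − U`, with `diam (h '' A) < δ`, and such that for every `G ∈ 𝒢` either
`diam (h '' G) < δ` or `h` is the identity on `G`. -/
def Squeezable {X : Type u} [MetricSpace X] (A : Set X) : Prop :=
  IsCompact A ∧
    ∀ 𝒢 : Set (Set X), IsUSCDecomposition 𝒢 → IsNullCollection 𝒢 → A ∈ 𝒢 →
      ∀ U : Set X, IsOpen U → A ⊆ U → ∀ δ : ℝ, 0 < δ →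
        ∃ h : X ≃ₜ X, (∀ x ∈ Uᶜ, h x = x) ∧ Metric.diam (⇑h '' A) < δ ∧
          ∀ G ∈ 𝒢, Metric.diam (⇑h '' G) < δ ∨ ∀ x ∈ G, h x = x

/-- A compact subset `A` of a metric space `X` is *squashable* if for every null
upper semi-continuous decomposition `𝒢` of `X` with `A ∈ 𝒢`, every open neighborhood `U`
of `A` and every `δ > 0`, there is a continuous map `f : X → X` in the closure (in `C(X,X)`)
of the set of homeomorphisms of `X` fixing `X − U` pointwise, such that `f '' A` is a
one-point set `{p}`, `f` maps `X − A` homeomorphically onto `X − {p}`, and for every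
`G ∈ 𝒢` either `diam (f '' G) < δ` or `f` is the identity on `G`. -/
def Squashable {X : Type u} [MetricSpace X] (A : Set X) : Prop :=
  IsCompact A ∧
    ∀ 𝒢 : Set (Set X), IsUSCDecomposition 𝒢 → IsNullCollection 𝒢 → A ∈ 𝒢 →
      ∀ U : Set X, IsOpen U → A ⊆ U → ∀ δ : ℝ, 0 < δ →
        ∃ (f : C(X, X)) (p : X),
          f ∈ closure ((fun h : X ≃ₜ X => (h : C(X, X))) ''
              {h : X ≃ₜ X | ∀ x ∈ Uᶜ, h x = x}) ∧
          ⇑f '' A = {p} ∧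
          MapsHomeomorphicallyOnto (⇑f) Aᶜ ({p}ᶜ) ∧
          ∀ G ∈ 𝒢, Metric.diam (⇑f '' G) < δ ∨ ∀ x ∈ G, f x = x

/-- `π` injects over `C` if `π` is injective on `π ⁻¹' C`. -/
def InjectsOver {X : Type u} {Y : Type v} (π : X → Y) (C : Set Y) : Prop :=
  Set.InjOn π (π ⁻¹' C)

/-- The strong shrinking criterion for an onto map `π : X → Y` between compact metric
spaces. -/
def SatisfiesStrongShrinkingCriterion {X : Type u} {Y : Type v} [MetricSpace X]
    [MetricSpace Y] (π : X → Y) : Prop :=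
  ∀ δ : ℝ, 0 < δ → ∀ C : Set Y, IsClosed C → InjectsOver π C →
    ∃ h : X ≃ₜ X,
      (∀ y : Y, Metric.diam (⇑h '' (π ⁻¹' {y})) < δ) ∧
      (∀ x : X, dist (π x) (π (h.symm x)) < δ) ∧
      ∀ x ∈ π ⁻¹' C, h x = x

/-- `π : X → Y` is a strong near homeomorphism. -/
def IsStrongNearHomeomorphism {X : Type u} {Y : Type v} [MetricSpace X]
    [MetricSpace Y] (π : X → Y) : Prop :=
  ∀ ε : ℝ, 0 < ε → ∀ C : Set Y, IsClosed C → InjectsOver π C →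
    ∃ f : X ≃ₜ Y, (∀ x : X, dist (π x) (f x) < ε) ∧ ∀ x ∈ π ⁻¹' C, f x = π x

/-- A subset of `ℝⁿ` is starlike if it is compact and contains a point `x` such that the
segment from `x` to any of its points lies in it. -/
def IsStarlike {n : ℕ} (A : Set (EuclideanSpace ℝ (Fin n))) : Prop :=
  IsCompact A ∧ ∃ x ∈ A, ∀ y ∈ A, segment ℝ x y ⊆ A

/-- A subset `A` of a space `X` is starlike-equivalent if some open neighborhood of `A`
embeds onto an open subset of some `ℝⁿ` (`n ≥ 1`) carrying `A` onto a starlike set. -/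
def IsStarlikeEquivalent {X : Type u} [TopologicalSpace X] (A : Set X) : Prop :=
  ∃ n : ℕ, 1 ≤ n ∧ ∃ U : Set X, IsOpen U ∧ A ⊆ U ∧
    ∃ e : U → EuclideanSpace ℝ (Fin n), Topology.IsEmbedding e ∧ IsOpen (Set.range e) ∧
      IsStarlike (e '' {x : U | (x : X) ∈ A})

/-- The image `A/B` of `A` in the quotient `X/B` of `X` obtained by identifying the
compact set `B ⊆ A` to a point is a squeezable subset of `X/B`, for some
(equivalently, by metric-independence, any) metric inducing the quotient topology.
The quotient `X/B` is modelled by an arbitrary compact metric space `Y` together with a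
continuous surjection `π : X → Y` whose fibers are `B` and the singletons of `X − B`
(such a map from the compact space `X` to the metrizable space `Y` is automatically a
closed quotient map, so `Y` is `X/B` with a metric inducing the quotient topology). -/
def SqueezableInQuotient {X : Type u} [MetricSpace X] (B A : Set X) : Prop :=
  ∃ (Y : Type u) (mY : MetricSpace Y) (π : X → Y),
    letI := mY
    Continuous π ∧ Function.Surjective π ∧
      (∀ x y : X, π x = π y ↔ x = y ∨ (x ∈ B ∧ y ∈ B)) ∧ Squeezable (π '' A)

/-- `A/B` is a squashable subset of `X/B`; see `SqueezableInQuotient`. -/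
def SquashableInQuotient {X : Type u} [MetricSpace X] (B A : Set X) : Prop :=
  ∃ (Y : Type u) (mY : MetricSpace Y) (π : X → Y),
    letI := mY
    Continuous π ∧ Function.Surjective π ∧
      (∀ x y : X, π x = π y ↔ x = y ∨ (x ∈ B ∧ y ∈ B)) ∧ Squashable (π '' A)

/-- `A/B` is a starlike-equivalent subset of `X/B`; see `SqueezableInQuotient`. -/
def StarlikeEquivalentInQuotient {X : Type u} [MetricSpace X] (B A : Set X) : Prop :=
  ∃ (Y : Type u) (mY : MetricSpace Y) (π : X → Y),
    letI := mY
    Continuous π ∧ Function.Surjective π ∧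
      (∀ x y : X, π x = π y ↔ x = y ∨ (x ∈ B ∧ y ∈ B)) ∧ IsStarlikeEquivalent (π '' A)

/-- `A` is recursively squeezable of filtration length `≤ n`: there is a chain
`A₁ ⊆ ⋯ ⊆ A_{n+1} = A` of compact subsets of `X` with `A₁` squeezable in `X` and
`A_{i+1}/A_i` squeezable in `X/A_i` for each `i`. -/
def RecursivelySqueezableOfLength {X : Type u} [MetricSpace X] (n : ℕ) (A : Set X) :
    Prop :=
  ∃ F : Fin (n + 1) → Set X,
    (∀ i, IsCompact (F i)) ∧ Monotone F ∧ F (Fin.last n) = A ∧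
    Squeezable (F 0) ∧ ∀ i : Fin n, SqueezableInQuotient (F i.castSucc) (F i.succ)

/-- `A` is recursively squeezable: recursively squeezable of filtration length `≤ n`
for some `n ≥ 0`. -/
def RecursivelySqueezable {X : Type u} [MetricSpace X] (A : Set X) : Prop :=
  ∃ n : ℕ, RecursivelySqueezableOfLength n A

/-- `A` is recursively squashable of filtration length `≤ n`. -/
def RecursivelySquashableOfLength {X : Type u} [MetricSpace X] (n : ℕ) (A : Set X) :
    Prop :=
  ∃ F : Fin (n + 1) → Set X,
    (∀ i, IsCompact (F i)) ∧ Monotone F ∧ F (Fin.last n) = A ∧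
    Squashable (F 0) ∧ ∀ i : Fin n, SquashableInQuotient (F i.castSucc) (F i.succ)

/-- `A` is recursively squashable. -/
def RecursivelySquashable {X : Type u} [MetricSpace X] (A : Set X) : Prop :=
  ∃ n : ℕ, RecursivelySquashableOfLength n A

/-- `A` is recursively starlike-equivalent of filtration length `≤ n`. -/
def RecursivelyStarlikeEquivalentOfLength {X : Type u} [MetricSpace X] (n : ℕ)
    (A : Set X) : Prop :=
  ∃ F : Fin (n + 1) → Set X,
    (∀ i, IsCompact (F i)) ∧ Monotone F ∧ F (Fin.last n) = A ∧
    IsStarlikeEquivalent (F 0) ∧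
    ∀ i : Fin n, StarlikeEquivalentInQuotient (F i.castSucc) (F i.succ)

/-- `A` is recursively starlike-equivalent. -/
def RecursivelyStarlikeEquivalent {X : Type u} [MetricSpace X] (A : Set X) : Prop :=
  ∃ n : ℕ, RecursivelyStarlikeEquivalentOfLength n A

/-- Uniformly continuous maps send sets of small diameter to sets of small diameter. -/
lemma UniformContinuous.exists_diam_image_lt {X : Type u} {Y : Type v} [PseudoMetricSpace X]
    [PseudoMetricSpace Y] {f : X → Y} (hf : UniformContinuous f) {ε : ℝ} (hε : 0 < ε) :
    ∃ δ > 0, ∀ s : Set X, Bornology.IsBounded s → diam s < δ → diam (f '' s) < ε := by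
  obtain ⟨δ, hδ, h⟩ := Metric.uniformContinuous_iff.1 hf (ε / 2) (half_pos hε)
  refine ⟨δ, hδ, fun s hs hsδ => ?_⟩
  refine (diam_le_of_forall_dist_le (half_pos hε).le ?_).trans_lt (half_lt_self hε)
  rintro _ ⟨x, hx, rfl⟩ _ ⟨y, hy, rfl⟩
  exact (h ((dist_le_diam_of_mem hs hx hy).trans_lt hsδ)).le

/-- A null partition of a metric space into nonempty compact sets. -/
structure IsNullPartition {X : Type u} [MetricSpace X] (𝒢 : Set (Set X)) : Prop where
  isCompact : ∀ G ∈ 𝒢, IsCompact G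
  nonempty : ∀ G ∈ 𝒢, G.Nonempty
  existsUnique : ∀ x : X, ∃! G, G ∈ 𝒢 ∧ x ∈ G
  isNull : IsNullCollection 𝒢

namespace IsNullPartition

variable {X : Type u} {Y : Type v} [MetricSpace X] [MetricSpace Y] {𝒢 : Set (Set X)}

lemma eq_of_mem (h : IsNullPartition 𝒢) {G H : Set X} (hG : G ∈ 𝒢) (hH : H ∈ 𝒢) {x : X}
    (hxG : x ∈ G) (hxH : x ∈ H) : G = H :=
  (h.existsUnique x).unique ⟨hG, hxG⟩ ⟨hH, hxH⟩

/-- The saturation of a closed set with respect to a null partition is closed. -/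
lemma isClosed_saturation (h : IsNullPartition 𝒢) {C : Set X} (hC : IsClosed C) :
    IsClosed {x | ∃ G ∈ 𝒢, x ∈ G ∧ (G ∩ C).Nonempty} := by
  set S := {x | ∃ G ∈ 𝒢, x ∈ G ∧ (G ∩ C).Nonempty}
  have hCS : C ⊆ S := fun x hx =>
    let ⟨G, hG, hxG⟩ := (h.existsUnique x).exists
    ⟨G, hG, hxG, x, hxG, hx⟩
  refine isClosed_of_closure_subset fun x hx => ?_
  by_contra hxS
  refine hxS (hCS ?_)
  rw [← hC.closure_eq, closure_eq_iInter_cthickening]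
  refine mem_iInter₂.2 fun ε hε => ?_
  let 𝒦 := {G | (G ∈ 𝒢 ∧ ε ≤ diam G) ∧ (G ∩ C).Nonempty}
  have h𝒦 : 𝒦.Finite := (h.isNull ε hε).subset fun G hG => hG.1
  have hcl : IsClosed (⋃₀ 𝒦) := by
    rw [sUnion_eq_biUnion]
    exact h𝒦.isClosed_biUnion fun G hG => (h.isCompact G hG.1.1).isClosed
  have hsub : S ⊆ ⋃₀ 𝒦 ∪ cthickening ε C := by
    rintro y ⟨G, hG, hyG, z, hzG, hzC⟩
    by_cases hd : ε ≤ diam G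
    · exact Or.inl ⟨G, ⟨⟨hG, hd⟩, z, hzG, hzC⟩, hyG⟩
    · refine Or.inr (mem_cthickening_of_dist_le y z ε C hzC ?_)
      exact (dist_le_diam_of_mem (h.isCompact G hG).isBounded hyG hzG).trans (not_le.1 hd).le
  rcases closure_minimal hsub (hcl.union isClosed_cthickening) hx with hx' | hx'
  · obtain ⟨G, hG, hxG⟩ := hx'
    exact absurd ⟨G, hG.1.1, hxG, hG.2⟩ hxS
  · exact hx'

lemma isUSCDecomposition (h : IsNullPartition 𝒢) : IsUSCDecomposition 𝒢 := by
  refine ⟨fun G hG => ⟨h.isCompact G hG, h.nonempty G hG⟩, h.existsUnique, fun C hC => ?_⟩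
  set r : X → X → Prop := fun x y => ∃ G ∈ 𝒢, x ∈ G ∧ y ∈ G
  have hr : Equivalence r :=
    { refl := fun x => let ⟨G, hG, hx⟩ := (h.existsUnique x).exists; ⟨G, hG, hx, hx⟩
      symm := fun ⟨G, hG, hx, hy⟩ => ⟨G, hG, hy, hx⟩
      trans := fun ⟨G, hG, hx, hy⟩ ⟨H, hH, hy', hz⟩ =>
        ⟨G, hG, hx, h.eq_of_mem hH hG hy' hy ▸ hz⟩ }
  rw [← isQuotientMap_quot_mk.isClosed_preimage]
  convert h.isClosed_saturation hC using 1
  ext x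
  constructor
  · rintro ⟨y, hy, hyx⟩
    obtain ⟨G, hG, hyG, hxG⟩ := (hr.quot_mk_eq_iff y x).1 hyx
    exact ⟨G, hG, hxG, y, hyG, hy⟩
  · rintro ⟨G, hG, hxG, y, hyG, hy⟩
    exact ⟨y, hy, Quot.sound ⟨G, hG, hyG, hxG⟩⟩

/-- The image of a null partition under a surjection collapsing at most one of its members. -/
lemma image [CompactSpace X] (h : IsNullPartition 𝒢) {f : X → Y} (hf : Continuous f)
    (hsurj : Surjective f) {A : Set X} (hA : A ∈ 𝒢)
    (hker : ∀ x y, f x = f y → x = y ∨ (x ∈ A ∧ y ∈ A)) :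
    IsNullPartition ((fun G => f '' G) '' 𝒢) where
  isCompact := by
    rintro _ ⟨G, hG, rfl⟩
    exact (h.isCompact G hG).image hf
  nonempty := by
    rintro _ ⟨G, hG, rfl⟩
    exact (h.nonempty G hG).image f
  existsUnique := by
    intro y
    obtain ⟨x, rfl⟩ := hsurj y
    obtain ⟨G, hG, hx⟩ := (h.existsUnique x).exists
    refine ⟨f '' G, ⟨⟨G, hG, rfl⟩, x, hx, rfl⟩, ?_⟩
    rintro _ ⟨⟨H, hH, rfl⟩, x', hx', hxx'⟩
    rcases hker _ _ hxx' with rfl | ⟨h1, h2⟩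
    · rw [h.eq_of_mem hG hH hx hx']
    · rw [h.eq_of_mem hH hA hx' h1, h.eq_of_mem hG hA hx h2]
  isNull := by
    intro ε hε
    obtain ⟨δ, hδ, hd⟩ :=
      (CompactSpace.uniformContinuous_of_continuous hf).exists_diam_image_lt hε
    refine ((h.isNull δ hδ).image fun G => f '' G).subset ?_
    rintro _ ⟨⟨G, hG, rfl⟩, hGε⟩
    refine ⟨G, ⟨hG, ?_⟩, rfl⟩
    by_contra! hlt
    exact absurd (hd G (h.isCompact G hG).isBounded hlt) (not_lt.2 hGε)

/-- Replace a member `A` of a null partition by a compact subset `B` and the points of `A \ B`. -/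
lemma refine_member (h : IsNullPartition 𝒢) {A B : Set X} (hA : A ∈ 𝒢) (hB : IsCompact B)
    (hBne : B.Nonempty) (hBA : B ⊆ A) :
    IsNullPartition ({B} ∪ ((𝒢 \ {A}) ∪ (fun x => {x}) '' (A \ B))) where
  isCompact := by
    rintro G (rfl | hG | ⟨x, -, rfl⟩)
    exacts [hB, h.isCompact G hG.1, isCompact_singleton]
  nonempty := by
    rintro G (rfl | hG | ⟨x, -, rfl⟩)
    exacts [hBne, h.nonempty G hG.1, singleton_nonempty x]
  existsUnique := by
    intro x
    have key : ∀ G ∈ 𝒢 \ {A}, x ∈ G → x ∉ A := fun G hG hxG hxA =>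
      hG.2 (h.eq_of_mem hG.1 hA hxG hxA)
    by_cases hxB : x ∈ B
    · refine ⟨B, ⟨Or.inl rfl, hxB⟩, ?_⟩
      rintro G ⟨rfl | hG | ⟨y, hy, rfl⟩, hxG⟩
      · rfl
      · exact absurd (hBA hxB) (key G hG hxG)
      · exact absurd (mem_singleton_iff.1 hxG ▸ hxB) hy.2
    · by_cases hxA : x ∈ A
      · refine ⟨{x}, ⟨Or.inr (Or.inr ⟨x, ⟨hxA, hxB⟩, rfl⟩), rfl⟩, ?_⟩
        rintro G ⟨rfl | hG | ⟨y, hy, rfl⟩, hxG⟩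
        · exact absurd hxG hxB
        · exact absurd hxA (key G hG hxG)
        · rw [mem_singleton_iff.1 hxG]
      · obtain ⟨G, hG, hxG⟩ := (h.existsUnique x).exists
        refine ⟨G, ⟨Or.inr (Or.inl ⟨hG, fun hGA => hxA (mem_singleton_iff.1 hGA ▸ hxG)⟩), hxG⟩, ?_⟩
        rintro H ⟨rfl | hH | ⟨y, hy, rfl⟩, hxH⟩
        · exact absurd hxH hxB
        · exact h.eq_of_mem hH.1 hG hxH hxG
        · exact absurd (mem_singleton_iff.1 hxH ▸ hy.1) hxA
  isNull := by
    intro ε hε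
    refine ((h.isNull ε hε).insert B).subset ?_
    rintro G ⟨rfl | hG | ⟨x, -, rfl⟩, hGε⟩
    · exact mem_insert _ _
    · exact mem_insert_of_mem _ ⟨hG.1, hGε⟩
    · exact absurd hGε (by simpa using hε)

end IsNullPartition

/-- `f` collapses exactly `A`: it is onto, and its point inverses are `A` and single points. -/
def CollapsesExactly {X : Type u} {Y : Type v} (f : X → Y) (A : Set X) : Prop :=
  Surjective f ∧ ∀ x y, f x = f y ↔ x = y ∨ (x ∈ A ∧ y ∈ A)

lemma collapsesExactly_of_mapsHomeomorphicallyOnto {X : Type u} {Y : Type v} [TopologicalSpace X]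
    [TopologicalSpace Y] {f : X → Y} {A : Set X} {p : Y} (hA : f '' A = {p})
    (h : MapsHomeomorphicallyOnto f Aᶜ {p}ᶜ) : CollapsesExactly f A := by
  obtain ⟨e, he⟩ := h
  have hp : ∀ x, f x = p ↔ x ∈ A := by
    refine fun x => ⟨fun hx => ?_, fun hx => hA.subset (mem_image_of_mem f hx)⟩
    by_contra hxA
    exact (e ⟨x, hxA⟩).2 ((he ⟨x, hxA⟩).trans hx)
  constructor
  · intro y
    by_cases hy : y = p
    · obtain ⟨x, -, hx⟩ := hA.superset (mem_singleton p)
      exact ⟨x, hx.trans hy.symm⟩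
    · exact ⟨e.symm ⟨y, hy⟩, by rw [← he, e.apply_symm_apply]⟩
  · refine fun x y => ⟨fun hxy => ?_, ?_⟩
    · by_cases hx : x ∈ A
      · exact Or.inr ⟨hx, (hp y).1 (hxy ▸ (hp x).2 hx)⟩
      · have hy : y ∉ A := fun hy => hx ((hp x).1 (hxy.trans ((hp y).2 hy)))
        have : e ⟨x, hx⟩ = e ⟨y, hy⟩ := Subtype.ext (by rw [he, he]; exact hxy)
        exact Or.inl (congrArg Subtype.val (e.injective this))
    · rintro (rfl | ⟨hx, hy⟩)
      · rfl
      · rw [(hp x).2 hx, (hp y).2 hy]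

lemma CollapsesExactly.mapsHomeomorphicallyOnto {X : Type u} {Y : Type v} [TopologicalSpace X]
    [CompactSpace X] [TopologicalSpace Y] [T2Space Y] {f : X → Y} {A : Set X}
    (h : CollapsesExactly f A) (hf : Continuous f) {a : X} (ha : a ∈ A) :
    f '' A = {f a} ∧ MapsHomeomorphicallyOnto f Aᶜ {f a}ᶜ := by
  have hp : ∀ x, f x = f a ↔ x ∈ A := fun x =>
    (h.2 x a).trans ⟨fun hx => hx.elim (fun hxa => hxa ▸ ha) And.left, fun hx => Or.inr ⟨hx, ha⟩⟩
  have hpre : f ⁻¹' {f a}ᶜ = Aᶜ := by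
    ext x
    simp [hp]
  refine ⟨Subset.antisymm ?_ (singleton_subset_iff.2 ⟨a, ha, rfl⟩), ?_⟩
  · rintro _ ⟨x, hx, rfl⟩
    exact (hp x).2 hx
  rw [← hpre]
  have hbij : Bijective (({f a}ᶜ : Set Y).restrictPreimage f) := by
    refine ⟨fun x y hxy => ?_, h.1.restrictPreimage _⟩
    rcases (h.2 x y).1 (congrArg Subtype.val hxy) with hxy | hxy
    · exact Subtype.ext hxy
    · exact absurd ((hp x).2 hxy.1) x.2
  exact ⟨(Equiv.ofBijective _ hbij).toHomeomorphOfContinuousClosed hf.restrictPreimage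
    (hf.isClosedMap.restrictPreimage _), fun x => rfl⟩

lemma CollapsesExactly.comp {X Y Z : Type*} {f : X → Y} {g : Y → Z} {A B : Set X}
    (hf : CollapsesExactly f B) (hBA : B ⊆ A) (hg : CollapsesExactly g (f '' A)) :
    CollapsesExactly (g ∘ f) A := by
  have hmem : ∀ x, f x ∈ f '' A ↔ x ∈ A := by
    refine fun x => ⟨?_, mem_image_of_mem f⟩
    rintro ⟨y, hy, hyx⟩
    rcases (hf.2 y x).1 hyx with rfl | hB
    exacts [hy, hBA hB.2]
  refine ⟨hg.1.comp hf.1, fun x y => ?_⟩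
  rw [comp_apply, comp_apply, hg.2, hf.2, hmem, hmem]
  have : x ∈ B ∧ y ∈ B → x ∈ A ∧ y ∈ A := And.imp (@hBA x) (@hBA y)
  tauto

/-- Two quotients of a compact space with the same fibers are homeomorphic. -/
lemma exists_homeomorph_of_same_fibers {X Y Z : Type*} [TopologicalSpace X] [CompactSpace X]
    [TopologicalSpace Y] [T2Space Y] [TopologicalSpace Z] [T2Space Z] {f : X → Y} {g : X → Z}
    (hf : Continuous f) (hfs : Surjective f) (hg : Continuous g) (hgs : Surjective g)
    (hfg : ∀ x y, f x = f y ↔ g x = g y) : ∃ φ : Y ≃ₜ Z, ∀ x, φ (f x) = g x := by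
  have hlift : ∀ x, g (surjInv hfs (f x)) = g x := fun x => (hfg _ _).1 (surjInv_eq hfs _)
  have hbij : Bijective (g ∘ surjInv hfs) := by
    constructor
    · intro y y' h
      rw [← surjInv_eq hfs y, ← surjInv_eq hfs y']
      exact (hfg _ _).2 h
    · intro z
      obtain ⟨x, rfl⟩ := hgs z
      exact ⟨f x, hlift x⟩
  have : CompactSpace Y := hfs.compactSpace hf
  have hcont : Continuous (g ∘ surjInv hfs) := by
    rw [(hf.isClosedMap.isQuotientMap hf hfs).continuous_iff]
    exact hg.congr fun x => (hlift x).symm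
  exact ⟨hcont.homeoOfEquivCompactToT2 (f := Equiv.ofBijective _ hbij), hlift⟩

/-- On a compact space, squashability only involves null partitions and collapsing maps. -/
lemma squashable_iff {X : Type u} [MetricSpace X] [CompactSpace X] {A : Set X} :
    Squashable A ↔ IsCompact A ∧ ∀ 𝒢 : Set (Set X), IsNullPartition 𝒢 → A ∈ 𝒢 →
      ∀ U : Set X, IsOpen U → A ⊆ U → ∀ δ : ℝ, 0 < δ →
        ∃ f : C(X, X),
          f ∈ closure ((fun h : X ≃ₜ X => (h : C(X, X))) ''
              {h : X ≃ₜ X | ∀ x ∈ Uᶜ, h x = x}) ∧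
          CollapsesExactly f A ∧
          ∀ G ∈ 𝒢, diam (f '' G) < δ ∨ ∀ x ∈ G, f x = x := by
  refine and_congr_right fun _ => ⟨fun h 𝒢 h𝒢 hA𝒢 U hU hAU δ hδ => ?_,
    fun h 𝒢 h𝒢 hnull hA𝒢 U hU hAU δ hδ => ?_⟩
  · obtain ⟨f, p, hf, hp, hmaps, hG⟩ :=
      h 𝒢 h𝒢.isUSCDecomposition h𝒢.isNull hA𝒢 U hU hAU δ hδ
    exact ⟨f, hf, collapsesExactly_of_mapsHomeomorphicallyOnto hp hmaps, hG⟩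
  · obtain ⟨f, hf, hc, hG⟩ := h 𝒢 ⟨fun G hG => (h𝒢.1 G hG).1, fun G hG => (h𝒢.1 G hG).2,
      h𝒢.2.1, hnull⟩ hA𝒢 U hU hAU δ hδ
    obtain ⟨a, ha⟩ := (h𝒢.1 A hA𝒢).2
    obtain ⟨hp, hmaps⟩ := hc.mapsHomeomorphicallyOnto f.continuous ha
    exact ⟨f, f a, hf, hp, hmaps, hG⟩

/-- Squashability is invariant under homeomorphisms of compact metric spaces. -/
lemma Squashable.image_homeomorph {X : Type u} {Y : Type v} [MetricSpace X] [CompactSpace X]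
    [MetricSpace Y] [CompactSpace Y] {D : Set Y} (hD : Squashable D) (φ : Y ≃ₜ X) :
    Squashable (φ '' D) := by
  rw [squashable_iff] at hD ⊢
  refine ⟨hD.1.image φ.continuous, fun 𝒢 h𝒢 hA𝒢 U hU hAU δ hδ => ?_⟩
  obtain ⟨δ', hδ', hd⟩ :=
    (CompactSpace.uniformContinuous_of_continuous φ.continuous).exists_diam_image_lt hδ
  obtain ⟨f, hf, hc, hG⟩ := hD.2 _ (h𝒢.image φ.symm.continuous φ.symm.surjective hA𝒢
    fun x y hxy => Or.inl (φ.symm.injective hxy)) ⟨_, hA𝒢, by simp [image_image]⟩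
    (φ ⁻¹' U) (hU.preimage φ.continuous) (image_subset_iff.1 hAU) δ' hδ'
  let conj : C(Y, Y) → C(X, X) := fun k => (φ : C(Y, X)).comp (k.comp (φ.symm : C(X, Y)))
  have hconj : Continuous conj :=
    (ContinuousMap.continuous_postcomp _).comp (ContinuousMap.continuous_precomp _)
  refine ⟨conj f, map_mem_closure hconj hf ?_, ⟨?_, fun x y => ?_⟩, fun G hG𝒢 => ?_⟩
  · rintro _ ⟨h, hh, rfl⟩
    refine ⟨(φ.symm.trans h).trans φ, fun x hx => ?_, rfl⟩
    have := hh (φ.symm x) (by simpa using hx)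
    simp [this]
  · exact φ.surjective.comp (hc.1.comp φ.symm.surjective)
  · have hmem : ∀ x, φ.symm x ∈ D ↔ x ∈ φ '' D := fun x => by
      rw [φ.image_eq_preimage_symm, mem_preimage]
    change φ (f (φ.symm x)) = φ (f (φ.symm y)) ↔ _
    rw [φ.injective.eq_iff, hc.2, φ.symm.injective.eq_iff, hmem, hmem]
  · have himg : conj f '' G = φ '' (f '' (φ.symm '' G)) := by
      simp only [image_image]
      rfl
    rcases hG _ ⟨G, hG𝒢, rfl⟩ with h | h
    · left
      rw [himg]
      exact hd _ (isCompact_univ.isBounded.subset (subset_univ _)) h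
    · right
      intro x hx
      change φ (f (φ.symm x)) = x
      rw [h _ (mem_image_of_mem _ hx), φ.apply_symm_apply]

/-- Squashing `B` and then `A / B` squashes `A`. -/
lemma Squashable.of_squashableInQuotient {X : Type u} [MetricSpace X] [CompactSpace X]
    {A B : Set X} (hB : Squashable B) (hA : IsCompact A) (hBA : B ⊆ A)
    (hq : SquashableInQuotient B A) : Squashable A := by
  obtain ⟨Y, mY, π, hπ, hπs, hker, hsq⟩ := hq
  have : CompactSpace Y := hπs.compactSpace hπ
  rcases B.eq_empty_or_nonempty with rfl | hBne
  · obtain ⟨φ, hφ⟩ := exists_homeomorph_of_same_fibers hπ hπs continuous_id surjective_id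
      fun x y => by simpa using hker x y
    simpa [image_image, hφ] using hsq.image_homeomorph φ
  rw [squashable_iff] at hB ⊢
  refine ⟨hA, fun 𝒢 h𝒢 hA𝒢 U hU hAU δ hδ => ?_⟩
  obtain ⟨f, hf, hfc, hfG⟩ := hB.2 _ (h𝒢.refine_member hA𝒢 hB.1 hBne hBA) (Or.inl rfl) U hU
    (hBA.trans hAU) δ hδ
  have hfix : ∀ x ∈ Uᶜ, f x = x := by
    intro x hx
    have hcl : IsClosed {k : C(X, X) | k x = x} :=
      isClosed_eq (continuous_eval_const x) continuous_const
    refine closure_minimal ?_ hcl hf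
    rintro _ ⟨h, hh, rfl⟩
    exact hh x hx
  have hfAU : f '' A ⊆ U := by
    rintro _ ⟨x, hx, rfl⟩
    by_contra hxU
    rcases (hfc.2 _ _).1 (hfix _ hxU) with h | h
    · exact hxU (h.symm ▸ hAU hx)
    · exact hxU (hAU (hBA h.1))
  obtain ⟨φ, hφ⟩ := exists_homeomorph_of_same_fibers hπ hπs f.continuous hfc.1
    fun x y => (hker x y).trans (hfc.2 x y).symm
  have hfA : Squashable (f '' A) := by
    simpa [image_image, hφ] using hsq.image_homeomorph φ
  rw [squashable_iff] at hfA
  obtain ⟨g, hg, hgc, hgG⟩ := hfA.2 _ (h𝒢.image f.continuous hfc.1 hA𝒢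
    fun x y hxy => ((hfc.2 x y).1 hxy).imp_right (And.imp (@hBA x) (@hBA y)))
    ⟨A, hA𝒢, rfl⟩ U hU hfAU δ hδ
  have hc : CollapsesExactly (g ∘ f) A := hfc.comp hBA hgc
  refine ⟨g.comp f, ?_, hc, fun G hG => ?_⟩
  · refine map_mem_closure₂ (f := fun g f : C(X, X) => g.comp f)
      (continuous_fst.compCM continuous_snd) hg hf ?_
    rintro _ ⟨k, hk, rfl⟩ _ ⟨h, hh, rfl⟩
    exact ⟨h.trans k, fun x hx => by simp [hh x hx, hk x hx], rfl⟩
  · by_cases hGA : G = A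
    · left
      have hsub : (g.comp f '' G).Subsingleton := by
        rintro _ ⟨x, hx, rfl⟩ _ ⟨y, hy, rfl⟩
        exact (hc.2 x y).2 (Or.inr ⟨hGA ▸ hx, hGA ▸ hy⟩)
      rwa [diam_subsingleton hsub]
    · rcases hgG _ ⟨G, hG, rfl⟩ with h | h
      · left
        rwa [ContinuousMap.coe_comp, image_comp]
      · have hgf : ∀ x ∈ G, g.comp f x = f x := fun x hx => h _ (mem_image_of_mem f hx)
        refine (hfG G (Or.inr (Or.inl ⟨hG, hGA⟩))).imp (fun hd => ?_) fun hid x hx =>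
          (hgf x hx).trans (hid x hx)
        rwa [image_congr hgf]

/-- **Theorem 4.** Every recursively squashable subset of a compact metrizable space is
squashable. -/
theorem recursivelySquashable_imp_squashable {X : Type u} [MetricSpace X] [CompactSpace X]
    (A : Set X) (hA : RecursivelySquashable A) : Squashable A := by
  obtain ⟨n, F, hF, hmono, rfl, h0, hstep⟩ := hA
  refine Fin.induction (motive := fun i => Squashable (F i)) h0 (fun i hi => ?_) (Fin.last n)
  exact hi.of_squashableInQuotient (hF _) (hmono (Fin.castSucc_le_succ i)) (hstep i)
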